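/- Let y : [0,∞) → ℝ be differentiable with y(t) ≥ 0, and suppose y'(t) + η y(t) ≤ C(1 + g(t)) e^{−η₁ t} for all t ≥ 0, where η > η₁ > 0, C > 0, and g ≥ 0 is measurable with ∫₀^∞ g(τ)² dτ < ∞. Then there exist constants C' > 0 and η' > 0 (depending on η, η₁, C, y(0), ∫g²) such that y(t) ≤ C' e^{−η' t} for all t ≥ 0. -/

import Mathlib

open Real MeasureTheory

/-- Grönwall inequality with square-integrable forcing: if y ≥ 0 and
y' + ηy ≤ C(1+g)e^{−η₁t} with ∫g² < ∞, then y decays exponentially. -/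
theorem stmt15 (η η₁ C : ℝ) (hη₁ : 0 < η₁) (hη : η₁ < η) (hC : 0 < C)
    (y g : ℝ → ℝ) (hy : Differentiable ℝ y) (hy0 : ∀ t, 0 ≤ y t)
    (hg : Measurable g) (hg0 : ∀ t, 0 ≤ g t)
    (hg2 : IntegrableOn (fun τ => g τ ^ 2) (Set.Ici (0 : ℝ)))
    (hineq : ∀ t : ℝ, 0 ≤ t → deriv y t + η * y t ≤ C * (1 + g t) * Real.exp (-η₁ * t)) :
    ∃ C' η' : ℝ, 0 < C' ∧ 0 < η' ∧ ∀ t : ℝ, 0 ≤ t → y t ≤ C' * Real.exp (-η' * t) := by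
  set δ := η - η₁ with hδ
  have hδ0 : 0 < δ := by linarith
  set G := ∫ τ in Set.Ici (0 : ℝ), g τ ^ 2 with hG
  have hG0 : 0 ≤ G := integral_nonneg fun τ => sq_nonneg (g τ)
  have hK : 0 < 2 * C / δ := by positivity
  refine ⟨y 0 + 2 * C / δ + C * G, η₁, by have := hy0 0; positivity, hη₁, fun t ht => ?_⟩
  let z : ℝ → ℝ := fun s => Real.exp (η * s) * y s - 2 * C / δ * Real.exp (δ * s)
  have hz (s : ℝ) : HasDerivAt z
      (Real.exp (η * s) * (deriv y s + η * y s) - 2 * C * Real.exp (δ * s)) s := by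
    have hexp (a : ℝ) : HasDerivAt (fun s => Real.exp (a * s)) (Real.exp (a * s) * a) s := by
      simpa using ((hasDerivAt_id s).const_mul a).exp
    refine (((hexp η).mul (hy s).hasDerivAt).sub ((hexp δ).const_mul (2 * C / δ))).congr_deriv ?_
    field_simp
    ring
  have hbound (s : ℝ) (hs : s ∈ Set.Ioo 0 t) :
      Real.exp (η * s) * (deriv y s + η * y s) - 2 * C * Real.exp (δ * s)
        ≤ C * Real.exp (δ * t) * g s ^ 2 := by
    have hmono : Real.exp (δ * s) ≤ Real.exp (δ * t) :=
      Real.exp_le_exp.2 (mul_le_mul_of_nonneg_left hs.2.le hδ0.le)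
    have hexp : Real.exp (η * s) * Real.exp (-η₁ * s) = Real.exp (δ * s) := by
      rw [← Real.exp_add, hδ]
      ring_nf
    calc _ ≤ Real.exp (η * s) * (C * (1 + g s) * Real.exp (-η₁ * s))
          - 2 * C * Real.exp (δ * s) := by gcongr; exact hineq s hs.1.le
      _ = C * Real.exp (δ * s) * (g s - 1) := by rw [← hexp]; ring
      _ ≤ C * Real.exp (δ * s) * g s ^ 2 := by
        gcongr
        nlinarith [sq_nonneg (g s - 1 / 2)]
      _ ≤ _ := by gcongr
  have hint : IntegrableOn (fun s => C * Real.exp (δ * t) * g s ^ 2) (Set.Icc 0 t) :=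
    (hg2.mono_set Set.Icc_subset_Ici_self).const_mul _
  have hmain := intervalIntegral.sub_le_integral_of_hasDeriv_right_of_le ht
    (fun s _ => (hz s).continuousAt.continuousWithinAt)
    (fun s _ => (hz s).hasDerivWithinAt) hint hbound
  rw [intervalIntegral.integral_const_mul, intervalIntegral.integral_of_le ht] at hmain
  have hle : ∫ s in Set.Ioc 0 t, g s ^ 2 ≤ G :=
    setIntegral_mono_set hg2 (ae_of_all _ fun s => sq_nonneg (g s))
      (Set.Ioc_subset_Icc_self.trans Set.Icc_subset_Ici_self).eventuallyLE
  have hCE : C * Real.exp (δ * t) * ∫ s in Set.Ioc 0 t, g s ^ 2 ≤ C * Real.exp (δ * t) * G := by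
    gcongr
  simp only [z, mul_zero, Real.exp_zero, one_mul, mul_one] at hmain
  have hE1 : 1 ≤ Real.exp (δ * t) := Real.one_le_exp (by positivity)
  have hy0E : y 0 ≤ y 0 * Real.exp (δ * t) := le_mul_of_one_le_right (hy0 0) hE1
  have hE : Real.exp (δ * t) = Real.exp (η * t) * Real.exp (-η₁ * t) := by
    rw [← Real.exp_add, hδ]
    ring_nf
  refine le_of_mul_le_mul_left ?_ (Real.exp_pos (η * t))
  calc Real.exp (η * t) * y t
      ≤ (y 0 + 2 * C / δ + C * G) * Real.exp (δ * t) := by linarith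
    _ = _ := by rw [hE]; ring
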